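/- arXiv:2508.08090 — 2 statements merged into one kernel-verified Lean document; each statement's English description precedes it below -/
import Mathlib

section
/- Let 0 < T ≤ ∞, let E : [0,T) → [0,∞) be bounded and lower semicontinuous, and let D : (0,T) → [0,∞) be Lebesgue integrable. Then the following two statements are equivalent. (i) For every ψ ∈ L¹((0,T);ℝ) such that the function φ(t) := −∫_{(t,T)} ψ(s) ds satisfies φ(t) ≥ 0 for all t ∈ [0,T), one has E(0)·φ(0) + ∫_{(0,T)} E(t) ψ(t) dt ≥ ∫_{(0,T)} D(t) φ(t) dt. (ii) There exists a Lebesgue null set N ⊆ (0,T) such that for every s ∈ {0} ∪ ((0,T) \ N) and every t with s ≤ t < T one has E(t) + ∫_{(s,t)} D(τ) dτ ≤ E(s). -/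
open MeasureTheory Set
open scoped ENNReal
open Filter Topology

/-- The part of the time interval `(0,T)` lying strictly after time `s`. -/
def timeTail (T : ℝ≥0∞) (s : ℝ) : Set ℝ := {u : ℝ | s < u ∧ ENNReal.ofReal u < T}

lemma mem_timeTail {T : ℝ≥0∞} {s u : ℝ} :
    u ∈ timeTail T s ↔ s < u ∧ ENNReal.ofReal u < T := Iff.rfl

lemma ofReal_lt_of_le {T : ℝ≥0∞} {s t : ℝ} (hst : s ≤ t) (ht : ENNReal.ofReal t < T) :
    ENNReal.ofReal s < T :=
  (ENNReal.ofReal_le_ofReal hst).trans_lt ht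

lemma isOpen_timeTail (T : ℝ≥0∞) (s : ℝ) : IsOpen (timeTail T s) :=
  isOpen_Ioi.inter (isOpen_Iio.preimage ENNReal.continuous_ofReal)

lemma measurableSet_timeTail (T : ℝ≥0∞) (s : ℝ) : MeasurableSet (timeTail T s) :=
  (isOpen_timeTail T s).measurableSet

lemma timeTail_subset_timeTail {T : ℝ≥0∞} {s t : ℝ} (hst : s ≤ t) :
    timeTail T t ⊆ timeTail T s :=
  fun _ hu => ⟨hst.trans_lt hu.1, hu.2⟩

lemma Ioo_subset_timeTail {T : ℝ≥0∞} {r s t : ℝ} (hrs : r ≤ s) (ht : ENNReal.ofReal t < T) :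
    Ioo s t ⊆ timeTail T r :=
  fun _ hu => ⟨hrs.trans_lt hu.1, ofReal_lt_of_le hu.2.le ht⟩

/-- A bounded function whose superlevel sets are, up to null sets, tails of the time interval has
nonpositive integral against any function with nonpositive tail integrals. -/
lemma setIntegral_mul_nonpos_of_ae_monotone {T : ℝ≥0∞} {G ψ : ℝ → ℝ} {N : Set ℝ} {M : ℝ}
    (hN : volume N = 0) (hG : AEStronglyMeasurable G (volume.restrict (timeTail T 0)))
    (hG_nonneg : ∀ t ∈ timeTail T 0, 0 ≤ G t) (hG_le : ∀ t ∈ timeTail T 0, G t ≤ M)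
    (hG_mono : ∀ s ∈ timeTail T 0, s ∉ N → ∀ t ∈ timeTail T 0, s ≤ t → G s ≤ G t)
    (hψ : IntegrableOn ψ (timeTail T 0))
    (hψ_tail : ∀ a, 0 ≤ a → ENNReal.ofReal a < T → ∫ u in timeTail T a, ψ u ≤ 0) :
    ∫ t in timeTail T 0, G t * ψ t ≤ 0 := by
  have hmeas := measurableSet_timeTail T 0
  have hslice : ∀ l : ℝ,
      ∫ t in timeTail T 0, {p : ℝ × ℝ | p.2 < G p.1}.indicator (fun _ => (1 : ℝ)) (t, l) * ψ t
        ≤ 0 := by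
    intro l
    have hae : ∀ᵐ t : ℝ, t ∉ N := compl_mem_ae_iff.2 hN
    let S : Set ℝ := {t | t ∈ timeTail T 0 ∧ t ∉ N ∧ l < G t}
    by_cases hS : S.Nonempty
    · have hbdd : BddBelow S := ⟨0, fun t ht => ht.1.1.le⟩
      obtain ⟨s₀, hs₀⟩ := hS
      have ha0 : 0 ≤ sInf S := le_csInf ⟨s₀, hs₀⟩ fun t ht => ht.1.1.le
      have haT : ENNReal.ofReal (sInf S) < T := ofReal_lt_of_le (csInf_le hbdd hs₀) hs₀.1.2
      refine le_of_eq_of_le ?_ (hψ_tail _ ha0 haT)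
      rw [← integral_indicator hmeas, ← integral_indicator (measurableSet_timeTail T _)]
      refine integral_congr_ae ?_
      filter_upwards [hae, (Measure.ae_ne volume (sInf S))] with t htN hta
      by_cases ht : t ∈ timeTail T 0
      · rcases lt_or_gt_of_ne hta with h | h
        · have h1 : t ∉ timeTail T (sInf S) := fun h' => absurd h'.1 h.le.not_gt
          have h2 : ¬ l < G t := fun h' => absurd (csInf_le hbdd ⟨ht, htN, h'⟩) h.not_ge
          simp [indicator, h1, h2]
        · have h1 : t ∈ timeTail T (sInf S) := ⟨h, ht.2⟩
          obtain ⟨s, hs, hst⟩ := exists_lt_of_csInf_lt ⟨s₀, hs₀⟩ h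
          have h2 : l < G t := hs.2.2.trans_le (hG_mono s hs.1 hs.2.1 t ht hst.le)
          simp [indicator, h1, h2, ht]
      · have h1 : t ∉ timeTail T (sInf S) := fun h' => ht (timeTail_subset_timeTail ha0 h')
        simp [h1, ht]
    · refine le_of_eq ?_
      rw [setIntegral_congr_ae (g := fun _ => 0) hmeas]
      · simp
      · filter_upwards [hae] with t htN ht
        have h2 : ¬ l < G t := fun h' => hS ⟨t, ht, htN, h'⟩
        simp [h2]
  have hnull : NullMeasurableSet {p : ℝ × ℝ | p.2 < G p.1}
      ((volume.restrict (timeTail T 0)).prod (volume.restrict (Ioo 0 M))) :=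
    nullMeasurableSet_lt measurable_snd.aemeasurable hG.comp_fst.aemeasurable
  have hint : Integrable (fun p : ℝ × ℝ =>
      {p : ℝ × ℝ | p.2 < G p.1}.indicator (fun _ => (1 : ℝ)) p * ψ p.1)
      ((volume.restrict (timeTail T 0)).prod (volume.restrict (Ioo 0 M))) := by
    refine (Integrable.comp_fst hψ _).bdd_mul (c := 1)
      (aestronglyMeasurable_const.indicator₀ hnull) (Eventually.of_forall fun p => ?_)
    exact (norm_indicator_le_norm_self _ _).trans (by simp)
  calc ∫ t in timeTail T 0, G t * ψ t
      = ∫ t in timeTail T 0, ∫ l in Ioo 0 M,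
          {p : ℝ × ℝ | p.2 < G p.1}.indicator (fun _ => (1 : ℝ)) (t, l) * ψ t := by
        refine setIntegral_congr_fun hmeas fun t ht => ?_
        rw [integral_mul_const]
        congr 1
        have : (fun l => {p : ℝ × ℝ | p.2 < G p.1}.indicator (fun _ => (1 : ℝ)) (t, l))
            = (Iio (G t)).indicator fun _ => (1 : ℝ) := by
          ext l; simp [indicator]
        rw [this, setIntegral_indicator measurableSet_Iio, ← Ioi_inter_Iio, inter_assoc,
          Iio_inter_Iio, inf_eq_right.2 (hG_le t ht), Ioi_inter_Iio]
        simp [hG_nonneg t ht]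
    _ = ∫ l in Ioo 0 M, ∫ t in timeTail T 0,
          {p : ℝ × ℝ | p.2 < G p.1}.indicator (fun _ => (1 : ℝ)) (t, l) * ψ t :=
        integral_integral_swap hint
    _ ≤ 0 := integral_nonpos hslice

/-- Integration by parts for the primitive of `D` and the tail integral of `ψ`. -/
lemma setIntegral_primitive_mul {T : ℝ≥0∞} {D ψ : ℝ → ℝ}
    (hD : IntegrableOn D (timeTail T 0)) (hψ : IntegrableOn ψ (timeTail T 0)) :
    ∫ t in timeTail T 0, (∫ τ in Ioo 0 t, D τ) * ψ t
      = ∫ τ in timeTail T 0, D τ * ∫ t in timeTail T τ, ψ t := by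
  have hmeas := measurableSet_timeTail T 0
  have hint : Integrable ({p : ℝ × ℝ | p.2 < p.1}.indicator fun p => ψ p.1 * D p.2)
      ((volume.restrict (timeTail T 0)).prod (volume.restrict (timeTail T 0))) :=
    (Integrable.mul_prod hψ hD).indicator (measurableSet_lt measurable_snd measurable_fst)
  calc ∫ t in timeTail T 0, (∫ τ in Ioo 0 t, D τ) * ψ t
      = ∫ t in timeTail T 0, ∫ τ in timeTail T 0,
          {p : ℝ × ℝ | p.2 < p.1}.indicator (fun p => ψ p.1 * D p.2) (t, τ) := by
        refine setIntegral_congr_fun hmeas fun t ht => ?_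
        have : (fun τ => {p : ℝ × ℝ | p.2 < p.1}.indicator (fun p => ψ p.1 * D p.2) (t, τ))
            = (Iio t).indicator fun τ => ψ t * D τ := by
          ext l; simp [indicator]
        have hset : timeTail T 0 ∩ Iio t = Ioo 0 t := by
          ext u
          exact ⟨fun h => ⟨h.1.1, h.2⟩, fun h => ⟨Ioo_subset_timeTail le_rfl ht.2 h, h.2⟩⟩
        rw [this, setIntegral_indicator measurableSet_Iio, hset, integral_const_mul, mul_comm]
    _ = ∫ τ in timeTail T 0, ∫ t in timeTail T 0,
          {p : ℝ × ℝ | p.2 < p.1}.indicator (fun p => ψ p.1 * D p.2) (t, τ) :=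
        integral_integral_swap hint
    _ = _ := by
        refine setIntegral_congr_fun hmeas fun τ hτ => ?_
        have : (fun t => {p : ℝ × ℝ | p.2 < p.1}.indicator (fun p => ψ p.1 * D p.2) (t, τ))
            = (Ioi τ).indicator fun t => ψ t * D τ := by
          ext l; simp [indicator]
        have hset : timeTail T 0 ∩ Ioi τ = timeTail T τ := by
          ext u
          exact ⟨fun h => ⟨h.2, h.1.2⟩, fun h => ⟨timeTail_subset_timeTail hτ.1.le h, h.1⟩⟩
        rw [this, setIntegral_indicator measurableSet_Ioi, hset, integral_mul_const, mul_comm]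

/-- The continuous function equal to `1` before `a`, to `0` after `b` and affine in between. -/
noncomputable def downRamp (a b u : ℝ) : ℝ := (b - a)⁻¹ * max 0 (b - max a u)

lemma continuous_downRamp (a b : ℝ) : Continuous (downRamp a b) := by
  unfold downRamp; fun_prop

lemma downRamp_nonneg {a b : ℝ} (hab : a < b) (u : ℝ) : 0 ≤ downRamp a b u :=
  mul_nonneg (inv_nonneg.2 (sub_pos.2 hab).le) (le_max_left _ _)

lemma downRamp_le_one {a b : ℝ} (hab : a < b) (u : ℝ) : downRamp a b u ≤ 1 := by
  rw [downRamp, inv_mul_le_one₀ (sub_pos.2 hab)]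
  exact max_le (sub_pos.2 hab).le (sub_le_sub_left (le_max_left _ _) _)

lemma downRamp_of_le {a b u : ℝ} (hab : a < b) (hu : u ≤ a) : downRamp a b u = 1 := by
  rw [downRamp, max_eq_left hu, max_eq_right (sub_pos.2 hab).le,
    inv_mul_cancel₀ (sub_pos.2 hab).ne']

lemma downRamp_of_ge {a b u : ℝ} (hu : b ≤ u) : downRamp a b u = 0 := by
  rw [downRamp, max_eq_left (sub_nonpos.2 (hu.trans (le_max_right _ _))), mul_zero]

lemma setIntegral_timeTail_indicator {T : ℝ≥0∞} {a b : ℝ} (hb : ENNReal.ofReal b < T) (u : ℝ) :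
    ∫ v in timeTail T u, (Ioo a b).indicator (fun _ => (b - a)⁻¹) v = downRamp a b u := by
  have hset : timeTail T u ∩ Ioo a b = Ioo (max a u) b := by
    ext v
    simp only [mem_inter_iff, mem_timeTail, mem_Ioo, max_lt_iff]
    exact ⟨fun h => ⟨⟨h.2.1, h.1.1⟩, h.2.2⟩,
      fun h => ⟨⟨h.1.2, ofReal_lt_of_le h.2.le hb⟩, h.1.1, h.2⟩⟩
  rw [setIntegral_indicator measurableSet_Ioo, hset]
  simp [downRamp, mul_comm, max_comm]

lemma mul_indicator_Ioo (E : ℝ → ℝ) (a b c : ℝ) :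
    (fun v => E v * (Ioo a b).indicator (fun _ => c) v)
      = (Ioo a b).indicator fun v => c * E v := by
  ext v; by_cases h : v ∈ Ioo a b <;> simp [h, mul_comm]

lemma setIntegral_mul_indicator_Ioo {T : ℝ≥0∞} {E : ℝ → ℝ} {a b c : ℝ} (ha : 0 ≤ a)
    (hb : ENNReal.ofReal b < T) :
    ∫ v in timeTail T 0, E v * (Ioo a b).indicator (fun _ => c) v = c * ∫ v in Ioo a b, E v := by
  rw [mul_indicator_Ioo, setIntegral_indicator measurableSet_Ioo,
    inter_eq_right.2 (Ioo_subset_timeTail ha hb), integral_const_mul]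

lemma integrableOn_indicator_Ioo (S : Set ℝ) (a b c : ℝ) :
    IntegrableOn ((Ioo a b).indicator fun _ => c) S :=
  ((integrable_indicator_iff measurableSet_Ioo).2 (integrableOn_const (by simp))).integrableOn

lemma setIntegral_Ioo_le_setIntegral_mul {T : ℝ≥0∞} {D φ : ℝ → ℝ} {a t : ℝ} (ha : 0 ≤ a)
    (ht : ENNReal.ofReal t < T) (hD : IntegrableOn D (timeTail T 0))
    (hD_nonneg : ∀ t ∈ timeTail T 0, 0 ≤ D t) (hφ : Continuous φ) {C : ℝ}
    (hφ_nonneg : ∀ u, 0 ≤ φ u) (hφ_le : ∀ u, φ u ≤ C) (hφ_one : ∀ u ∈ Ioo a t, 1 ≤ φ u) :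
    ∫ τ in Ioo a t, D τ ≤ ∫ τ in timeTail T 0, D τ * φ τ := by
  have hsub : Ioo a t ⊆ timeTail T 0 := Ioo_subset_timeTail ha ht
  have hmul : IntegrableOn (fun τ => D τ * φ τ) (timeTail T 0) :=
    hD.mul_bdd (c := C) hφ.aestronglyMeasurable (Eventually.of_forall fun u => by
      rw [Real.norm_eq_abs, abs_of_nonneg (hφ_nonneg u)]; exact hφ_le u)
  calc ∫ τ in Ioo a t, D τ ≤ ∫ τ in Ioo a t, D τ * φ τ :=
        setIntegral_mono_on (hD.mono_set hsub) (hmul.mono_set hsub) measurableSet_Ioo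
          fun u hu => le_mul_of_one_le_right (hD_nonneg u (hsub hu)) (hφ_one u hu)
    _ ≤ _ := setIntegral_mono_set hmul
        ((ae_restrict_iff' (measurableSet_timeTail T 0)).2 <| Eventually.of_forall
          fun u hu => mul_nonneg (hD_nonneg u hu) (hφ_nonneg u)) hsub.eventuallyLE

/-- The energy inequality tested against nonnegative absolutely continuous functions vanishing at
the final time, each given by its derivative `ψ`. -/
def VariationalEnergyInequality (T : ℝ≥0∞) (E D : ℝ → ℝ) : Prop :=
  ∀ ψ : ℝ → ℝ, IntegrableOn ψ (timeTail T 0) →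
    (∀ t : ℝ, 0 ≤ t → ENNReal.ofReal t < T → 0 ≤ -(∫ u in timeTail T t, ψ u)) →
    (∫ t in timeTail T 0, D t * (-(∫ u in timeTail T t, ψ u)))
      ≤ E 0 * (-(∫ u in timeTail T 0, ψ u)) + ∫ t in timeTail T 0, E t * ψ t

section

variable {T : ℝ≥0∞} {E D : ℝ → ℝ}

lemma VariationalEnergyInequality.average_add_setIntegral_le_initial
    (h : VariationalEnergyInequality T E D) (hD : IntegrableOn D (timeTail T 0))
    (hD_nonneg : ∀ t ∈ timeTail T 0, 0 ≤ D t) {t b : ℝ} (ht : 0 ≤ t) (htb : t < b)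
    (hb : ENNReal.ofReal b < T) :
    (b - t)⁻¹ * (∫ v in Ioo t b, E v) + ∫ τ in Ioo 0 t, D τ ≤ E 0 := by
  have hφ : ∀ u, -(∫ v in timeTail T u, -(Ioo t b).indicator (fun _ => (b - t)⁻¹) v)
      = downRamp t b u := fun u => by
    rw [integral_neg, neg_neg, setIntegral_timeTail_indicator hb]
  have key := h (fun v => -(Ioo t b).indicator (fun _ => (b - t)⁻¹) v)
    (integrableOn_indicator_Ioo _ _ _ _).neg
    (fun u _ _ => by rw [hφ]; exact downRamp_nonneg htb u)
  simp only [hφ, downRamp_of_le htb ht] at key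
  simp only [mul_neg, integral_neg, setIntegral_mul_indicator_Ioo ht hb] at key
  have := setIntegral_Ioo_le_setIntegral_mul le_rfl (ofReal_lt_of_le htb.le hb) hD hD_nonneg
    (continuous_downRamp t b) (downRamp_nonneg htb) (downRamp_le_one htb)
    (fun u hu => (downRamp_of_le htb hu.2.le).ge)
  linarith

lemma VariationalEnergyInequality.average_add_setIntegral_le_average
    (h : VariationalEnergyInequality T E D) (hD : IntegrableOn D (timeTail T 0))
    (hD_nonneg : ∀ t ∈ timeTail T 0, 0 ≤ D t)
    (hE : ∀ a b, 0 ≤ a → ENNReal.ofReal b < T → IntegrableOn E (Ioo a b))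
    {s a t b : ℝ} (hs : 0 < s) (hsa : s < a) (hat : a ≤ t) (htb : t < b)
    (hb : ENNReal.ofReal b < T) :
    (b - t)⁻¹ * (∫ v in Ioo t b, E v) + ∫ τ in Ioo a t, D τ
      ≤ (a - s)⁻¹ * ∫ v in Ioo s a, E v := by
  have ht0 : 0 ≤ t := (hs.trans hsa).le.trans hat
  have ha : ENNReal.ofReal a < T := ofReal_lt_of_le (hat.trans htb.le) hb
  have hφ : ∀ u, -(∫ v in timeTail T u, ((Ioo s a).indicator (fun _ => (a - s)⁻¹) v
      - (Ioo t b).indicator (fun _ => (b - t)⁻¹) v)) = downRamp t b u - downRamp s a u :=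
    fun u => by
      rw [integral_sub (integrableOn_indicator_Ioo _ _ _ _) (integrableOn_indicator_Ioo _ _ _ _),
        setIntegral_timeTail_indicator hb, setIntegral_timeTail_indicator ha, neg_sub]
  have hnonneg : ∀ u, 0 ≤ downRamp t b u - downRamp s a u := fun u => by
    rcases le_total u t with hu | hu
    · rw [downRamp_of_le htb hu]
      exact sub_nonneg.2 (downRamp_le_one hsa u)
    · rw [downRamp_of_ge (hat.trans hu), sub_zero]
      exact downRamp_nonneg htb u
  have hEmul : ∀ {x y c : ℝ}, 0 ≤ x → ENNReal.ofReal y < T →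
      IntegrableOn (fun v => E v * (Ioo x y).indicator (fun _ => c) v) (timeTail T 0) := by
    intro x y c hx hy
    rw [mul_indicator_Ioo]
    exact ((integrable_indicator_iff measurableSet_Ioo).2
      ((hE x y hx hy).const_mul c)).integrableOn
  have key := h (fun v => (Ioo s a).indicator (fun _ => (a - s)⁻¹) v
      - (Ioo t b).indicator (fun _ => (b - t)⁻¹) v)
    ((integrableOn_indicator_Ioo _ _ _ _).sub (integrableOn_indicator_Ioo _ _ _ _))
    (fun u _ _ => by rw [hφ]; exact hnonneg u)
  simp only [hφ, mul_sub (E _)] at key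
  rw [integral_sub (hEmul hs.le ha) (hEmul ht0 hb), setIntegral_mul_indicator_Ioo hs.le ha,
    setIntegral_mul_indicator_Ioo ht0 hb, downRamp_of_le htb ht0, downRamp_of_le hsa hs.le] at key
  have := setIntegral_Ioo_le_setIntegral_mul (hs.trans hsa).le (ofReal_lt_of_le htb.le hb) hD
    hD_nonneg ((continuous_downRamp t b).sub (continuous_downRamp s a)) (C := 1) hnonneg
    (fun u => (sub_le_self _ (downRamp_nonneg hsa u)).trans (downRamp_le_one htb u))
    (fun u hu => by
      rw [Pi.sub_apply, downRamp_of_le htb hu.2.le, downRamp_of_ge hu.1.le, sub_zero])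
  simp only [Pi.sub_apply] at this
  linarith

/-- Right averages of a lower semicontinuous function are eventually larger than any number
strictly below its value. -/
lemma exists_le_average_Ioo_of_lowerSemicontinuousOn
    (hE_lsc : LowerSemicontinuousOn E {t : ℝ | 0 ≤ t ∧ ENNReal.ofReal t < T})
    (hE : ∀ a b, 0 ≤ a → ENNReal.ofReal b < T → IntegrableOn E (Ioo a b))
    {t c : ℝ} (ht : 0 ≤ t) (htT : ENNReal.ofReal t < T) (hc : c < E t) :
    ∃ b, t < b ∧ ENNReal.ofReal b < T ∧ c ≤ (b - t)⁻¹ * ∫ v in Ioo t b, E v := by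
  have h1 : ∀ᶠ v in 𝓝 t, v ∈ {t : ℝ | 0 ≤ t ∧ ENNReal.ofReal t < T} → c < E v :=
    eventually_nhdsWithin_iff.1 (hE_lsc t ⟨ht, htT⟩ c hc)
  have h2 : ∀ᶠ v in 𝓝 t, ENNReal.ofReal v < T :=
    ENNReal.continuous_ofReal.continuousAt.eventually_lt_const htT
  obtain ⟨δ, hδ, hball⟩ := Metric.eventually_nhds_iff.1 (h1.and h2)
  have hdist : ∀ v ∈ Ioc t (t + δ / 2), dist v t < δ := fun v hv => by
    rw [Real.dist_eq, abs_of_pos (sub_pos.2 hv.1)]; linarith [hv.2]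
  have hb : t < t + δ / 2 := by linarith
  have hbT : ENNReal.ofReal (t + δ / 2) < T := (hball (hdist _ ⟨hb, le_rfl⟩)).2
  refine ⟨t + δ / 2, hb, hbT, ?_⟩
  rw [le_inv_mul_iff₀ (sub_pos.2 hb)]
  have hmono : ∫ _ in Ioo t (t + δ / 2), c ≤ ∫ v in Ioo t (t + δ / 2), E v :=
    setIntegral_mono_on (integrableOn_const (by simp)) (hE _ _ ht hbT) measurableSet_Ioo
      fun v hv => ((hball (hdist v ⟨hv.1, hv.2.le⟩)).1
        ⟨ht.trans hv.1.le, ofReal_lt_of_le hv.2.le hbT⟩).le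
  simpa [max_eq_left (half_pos hδ).le] using hmono

lemma aestronglyMeasurable_of_lowerSemicontinuousOn
    (hE_lsc : LowerSemicontinuousOn E {t : ℝ | 0 ≤ t ∧ ENNReal.ofReal t < T}) :
    AEStronglyMeasurable E (volume.restrict (timeTail T 0)) := by
  have h : LowerSemicontinuousOn E (timeTail T 0) := hE_lsc.mono fun t ht => ⟨ht.1.le, ht.2⟩
  exact (aemeasurable_restrict_of_measurable_subtype (measurableSet_timeTail T 0)
    (lowerSemicontinuous_restrict_iff.2 h).measurable).aestronglyMeasurable

lemma setIntegral_Ioo_eq_intervalIntegral_indicator {s t : ℝ} (hs : 0 ≤ s) (hst : s ≤ t)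
    (ht : ENNReal.ofReal t < T) (f : ℝ → ℝ) :
    ∫ v in Ioo s t, f v = ∫ v in s..t, (timeTail T 0).indicator f v := by
  rw [intervalIntegral.integral_of_le hst, integral_Ioc_eq_integral_Ioo]
  exact setIntegral_congr_fun measurableSet_Ioo fun v hv =>
    (indicator_of_mem (Ioo_subset_timeTail hs ht hv) f).symm

lemma VariationalEnergyInequality.exists_null_set
    (h : VariationalEnergyInequality T E D) (hT : 0 < T)
    (hE_nonneg : ∀ t : ℝ, 0 ≤ t → ENNReal.ofReal t < T → 0 ≤ E t)
    {M : ℝ} (hE_le : ∀ t : ℝ, 0 ≤ t → ENNReal.ofReal t < T → E t ≤ M)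
    (hE_lsc : LowerSemicontinuousOn E {t : ℝ | 0 ≤ t ∧ ENNReal.ofReal t < T})
    (hD_nonneg : ∀ t ∈ timeTail T 0, 0 ≤ D t) (hD : IntegrableOn D (timeTail T 0)) :
    ∃ N : Set ℝ, N ⊆ timeTail T 0 ∧ volume N = 0 ∧
      ∀ s : ℝ, (s = 0 ∨ (s ∈ timeTail T 0 ∧ s ∉ N)) →
        ∀ t : ℝ, s ≤ t → ENNReal.ofReal t < T → E t + ∫ τ in Ioo s t, D τ ≤ E s := by
  have hmeas := measurableSet_timeTail T 0
  have hM : 0 ≤ M := (hE_nonneg 0 le_rfl (by simpa)).trans (hE_le 0 le_rfl (by simpa))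
  have hloc : LocallyIntegrable ((timeTail T 0).indicator E) := by
    refine (locallyIntegrable_const M).mono ((aestronglyMeasurable_indicator_iff hmeas).2
      (aestronglyMeasurable_of_lowerSemicontinuousOn hE_lsc)) (Eventually.of_forall fun t => ?_)
    by_cases ht : t ∈ timeTail T 0
    · rw [indicator_of_mem ht, Real.norm_of_nonneg (hE_nonneg t ht.1.le ht.2),
        Real.norm_of_nonneg hM]
      exact hE_le t ht.1.le ht.2
    · simp [ht]
  have hE_int : ∀ a b, 0 ≤ a → ENNReal.ofReal b < T → IntegrableOn E (Ioo a b) := by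
    intro a b ha hb
    refine (((hloc.integrableOn_isCompact isCompact_Icc).mono_set
      (Ioo_subset_Icc_self (a := a) (b := b))).congr_fun (fun v hv => ?_) measurableSet_Ioo)
    exact indicator_of_mem (Ioo_subset_timeTail ha hb hv) E
  have hinterval : ∀ x y : ℝ, IntervalIntegrable ((timeTail T 0).indicator E) volume x y :=
    fun x y => intervalIntegrable_iff.2
      ((hloc.integrableOn_isCompact isCompact_uIcc).mono_set uIoc_subset_uIcc)
  have hD' : Integrable ((timeTail T 0).indicator D) := (integrable_indicator_iff hmeas).2 hD
  refine ⟨{s | s ∈ timeTail T 0 ∧ ¬ ∀ c : ℝ,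
      HasDerivAt (fun x => ∫ v in c..x, (timeTail T 0).indicator E v)
        ((timeTail T 0).indicator E s) s}, fun s hs => hs.1,
    measure_mono_null (fun s hs => hs.2)
      (ae_iff.1 (_root_.LocallyIntegrable.ae_hasDerivAt_integral hloc)), ?_⟩
  rintro s hs t hst htT
  have hs0 : 0 ≤ s := hs.elim (fun h => h.ge) fun h => h.1.1.le
  refine le_of_forall_lt_imp_le_of_dense fun c hc => ?_
  obtain ⟨b, htb, hb, hcb⟩ := exists_le_average_Ioo_of_lowerSemicontinuousOn hE_lsc hE_int
    (hs0.trans hst) htT (sub_lt_iff_lt_add.2 hc : c - ∫ τ in Ioo s t, D τ < E t)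
  rcases hs with rfl | ⟨hsT, hsN⟩
  · linarith [h.average_add_setIntegral_le_initial hD hD_nonneg hst htb hb]
  rcases hst.eq_or_lt with rfl | hst'
  · simpa using hc.le
  have hderiv : HasDerivAt (fun x => ∫ v in (0 : ℝ)..x, (timeTail T 0).indicator E v) (E s) s := by
    have : ∀ c : ℝ, HasDerivAt (fun x => ∫ v in c..x, (timeTail T 0).indicator E v)
        ((timeTail T 0).indicator E s) s := by
      by_contra hcon
      exact hsN ⟨hsT, hcon⟩
    simpa [indicator_of_mem hsT] using this 0
  have hlim : Tendsto (fun ε => (c - ∫ τ in Ioo s t, D τ) +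
      ((∫ τ in (0 : ℝ)..t, (timeTail T 0).indicator D τ)
        - ∫ τ in (0 : ℝ)..(s + ε), (timeTail T 0).indicator D τ)) (𝓝[>] 0)
      (𝓝 ((c - ∫ τ in Ioo s t, D τ) + ((∫ τ in (0 : ℝ)..t, (timeTail T 0).indicator D τ)
        - ∫ τ in (0 : ℝ)..(s + 0), (timeTail T 0).indicator D τ))) := by
    have hcont : Continuous fun x => ∫ τ in (0 : ℝ)..x, (timeTail T 0).indicator D τ :=
      intervalIntegral.continuous_primitive (fun _ _ => hD'.intervalIntegrable) 0
    have hcont' : Continuous fun ε => (c - ∫ τ in Ioo s t, D τ) +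
      ((∫ τ in (0 : ℝ)..t, (timeTail T 0).indicator D τ)
        - ∫ τ in (0 : ℝ)..(s + ε), (timeTail T 0).indicator D τ) :=
      continuous_const.add (continuous_const.sub (hcont.comp (continuous_const.add continuous_id)))
    exact (hcont'.tendsto 0).mono_left nhdsWithin_le_nhds
  rw [add_zero, intervalIntegral.integral_interval_sub_left hD'.intervalIntegrable
    hD'.intervalIntegrable, ← setIntegral_Ioo_eq_intervalIntegral_indicator hs0 hst htT,
    sub_add_cancel] at hlim
  refine le_of_tendsto_of_tendsto hlim hderiv.tendsto_slope_zero_right ?_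
  filter_upwards [Ioo_mem_nhdsGT (sub_pos.2 hst')] with ε hε
  have hsε : s < s + ε := by linarith [hε.1]
  have hεt : s + ε ≤ t := by linarith [hε.2]
  rw [intervalIntegral.integral_interval_sub_left hD'.intervalIntegrable hD'.intervalIntegrable,
    intervalIntegral.integral_interval_sub_left (hinterval _ _) (hinterval _ _),
    ← setIntegral_Ioo_eq_intervalIntegral_indicator (hs0.trans hsε.le) hεt htT,
    ← setIntegral_Ioo_eq_intervalIntegral_indicator hs0 hsε.le (ofReal_lt_of_le hεt htT)]
  have key := h.average_add_setIntegral_le_average hD hD_nonneg hE_int hsT.1 hsε hεt htb hb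
  rw [add_sub_cancel_left] at key
  rw [smul_eq_mul]
  linarith

lemma variationalEnergyInequality_of_null_set
    (hE_nonneg : ∀ t : ℝ, 0 ≤ t → ENNReal.ofReal t < T → 0 ≤ E t)
    {M : ℝ} (hE_le : ∀ t : ℝ, 0 ≤ t → ENNReal.ofReal t < T → E t ≤ M)
    (hE : AEStronglyMeasurable E (volume.restrict (timeTail T 0)))
    (hD_nonneg : ∀ t ∈ timeTail T 0, 0 ≤ D t) (hD : IntegrableOn D (timeTail T 0))
    {N : Set ℝ} (hN : volume N = 0)
    (h : ∀ s : ℝ, (s = 0 ∨ (s ∈ timeTail T 0 ∧ s ∉ N)) →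
      ∀ t : ℝ, s ≤ t → ENNReal.ofReal t < T → E t + ∫ τ in Ioo s t, D τ ≤ E s) :
    VariationalEnergyInequality T E D := by
  intro ψ hψ hφ
  have hmeas := measurableSet_timeTail T 0
  have hD' : Integrable ((timeTail T 0).indicator D) := (integrable_indicator_iff hmeas).2 hD
  have hA_nonneg : ∀ t ∈ timeTail T 0, 0 ≤ ∫ τ in Ioo 0 t, D τ := fun t ht =>
    setIntegral_nonneg measurableSet_Ioo fun u hu =>
      hD_nonneg u (Ioo_subset_timeTail le_rfl ht.2 hu)
  have hA_add : ∀ s ∈ timeTail T 0, ∀ t ∈ timeTail T 0, s ≤ t →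
      (∫ τ in Ioo 0 s, D τ) + ∫ τ in Ioo s t, D τ = ∫ τ in Ioo 0 t, D τ := by
    intro s hs t ht hst
    rw [setIntegral_Ioo_eq_intervalIntegral_indicator le_rfl hs.1.le hs.2,
      setIntegral_Ioo_eq_intervalIntegral_indicator hs.1.le hst ht.2,
      setIntegral_Ioo_eq_intervalIntegral_indicator le_rfl ht.1.le ht.2]
    exact intervalIntegral.integral_add_adjacent_intervals hD'.intervalIntegrable
      hD'.intervalIntegrable
  have hA : AEStronglyMeasurable (fun t => ∫ τ in Ioo 0 t, D τ)
      (volume.restrict (timeTail T 0)) := by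
    have hcont : Continuous fun x => ∫ τ in (0 : ℝ)..x, (timeTail T 0).indicator D τ :=
      intervalIntegral.continuous_primitive (fun _ _ => hD'.intervalIntegrable) 0
    refine hcont.aestronglyMeasurable.congr ((ae_restrict_iff' hmeas).2 <|
      Eventually.of_forall fun t ht => ?_)
    exact (setIntegral_Ioo_eq_intervalIntegral_indicator le_rfl ht.1.le ht.2 D).symm
  have hEψ : IntegrableOn (fun t => E t * ψ t) (timeTail T 0) :=
    Integrable.bdd_mul (c := M) hψ hE ((ae_restrict_iff' hmeas).2 <|
      Eventually.of_forall fun t ht => by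
        rw [Real.norm_of_nonneg (hE_nonneg t ht.1.le ht.2)]; exact hE_le t ht.1.le ht.2)
  have h0 : ∀ t ∈ timeTail T 0, E t + ∫ τ in Ioo 0 t, D τ ≤ E 0 := fun t ht =>
    h 0 (Or.inl rfl) t ht.1.le ht.2
  have hAψ : IntegrableOn (fun t => (∫ τ in Ioo 0 t, D τ) * ψ t) (timeTail T 0) :=
    Integrable.bdd_mul (c := E 0) hψ hA ((ae_restrict_iff' hmeas).2 <|
      Eventually.of_forall fun t ht => by
        rw [Real.norm_of_nonneg (hA_nonneg t ht)]
        linarith [h0 t ht, hE_nonneg t ht.1.le ht.2])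
  have key := setIntegral_mul_nonpos_of_ae_monotone (T := T) (ψ := ψ) (M := E 0)
    (G := fun t => E 0 - (E t + ∫ τ in Ioo 0 t, D τ)) hN
    (aestronglyMeasurable_const.sub (hE.add hA))
    (fun t ht => sub_nonneg.2 (h0 t ht))
    (fun t ht => sub_le_self _ (add_nonneg (hE_nonneg t ht.1.le ht.2) (hA_nonneg t ht)))
    (fun s hs hsN t ht hst => by
      have := h s (Or.inr ⟨hs, hsN⟩) t hst ht.2
      linarith [hA_add s hs t ht hst])
    hψ (fun a ha haT => neg_nonneg.1 (hφ a ha haT))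
  simp only [sub_mul, add_mul] at key
  rw [integral_sub (hψ.const_mul _) (Integrable.fun_add hEψ hAψ), integral_add hEψ hAψ,
    integral_const_mul, setIntegral_primitive_mul hD hψ] at key
  simp only [mul_neg, integral_neg]
  linarith

end

/-- Lemma A.4: for `0 < T ≤ ∞` (encoded as `T : ℝ≥0∞`), `E : [0,T) → [0,∞)`
bounded and lower semicontinuous, and `D : (0,T) → [0,∞)` integrable, the variational
energy inequality tested against all nonnegative `W^{1,1}` functions vanishing at `T`
(encoded via `φ(t) = −∫_{(t,T)} ψ` for `ψ ∈ L¹(0,T)`) is equivalent to the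
pointwise-in-time energy inequality off a null set. -/
theorem energy_inequality_equivalence
    (T : ℝ≥0∞) (hT : 0 < T) (E D : ℝ → ℝ)
    (hE_nonneg : ∀ t : ℝ, 0 ≤ t → ENNReal.ofReal t < T → 0 ≤ E t)
    (hE_bdd : ∃ M : ℝ, ∀ t : ℝ, 0 ≤ t → ENNReal.ofReal t < T → E t ≤ M)
    (hE_lsc : LowerSemicontinuousOn E {t : ℝ | 0 ≤ t ∧ ENNReal.ofReal t < T})
    (hD_nonneg : ∀ t : ℝ, 0 < t → ENNReal.ofReal t < T → 0 ≤ D t)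
    (hD_int : IntegrableOn D {t : ℝ | 0 < t ∧ ENNReal.ofReal t < T}) :
    ((∀ ψ : ℝ → ℝ,
        IntegrableOn ψ {t : ℝ | 0 < t ∧ ENNReal.ofReal t < T} →
        (∀ t : ℝ, 0 ≤ t → ENNReal.ofReal t < T →
          0 ≤ -(∫ u in {u : ℝ | t < u ∧ ENNReal.ofReal u < T}, ψ u)) →
        (∫ t in {t : ℝ | 0 < t ∧ ENNReal.ofReal t < T},
            D t * (-(∫ u in {u : ℝ | t < u ∧ ENNReal.ofReal u < T}, ψ u)))
          ≤ E 0 * (-(∫ u in {u : ℝ | (0:ℝ) < u ∧ ENNReal.ofReal u < T}, ψ u))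
              + ∫ t in {t : ℝ | 0 < t ∧ ENNReal.ofReal t < T}, E t * ψ t)
      ↔
      (∃ N : Set ℝ, N ⊆ {t : ℝ | 0 < t ∧ ENNReal.ofReal t < T} ∧ volume N = 0 ∧
        ∀ s : ℝ, (s = 0 ∨ ((0 < s ∧ ENNReal.ofReal s < T) ∧ s ∉ N)) →
          ∀ t : ℝ, s ≤ t → ENNReal.ofReal t < T →
            E t + ∫ τ in Ioo s t, D τ ≤ E s)) := by
  obtain ⟨M, hM⟩ := hE_bdd
  constructor
  · intro h
    exact VariationalEnergyInequality.exists_null_set h hT hE_nonneg hM hE_lsc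
      (fun t ht => hD_nonneg t ht.1 ht.2) hD_int
  · rintro ⟨N, -, hN, h⟩
    exact variationalEnergyInequality_of_null_set hE_nonneg hM
      (aestronglyMeasurable_of_lowerSemicontinuousOn hE_lsc)
      (fun t ht => hD_nonneg t ht.1 ht.2) hD_int hN h
end

section
/- Let X and Y be real Banach spaces, let j : Y → X be an injective continuous linear map, and assume that the adjoint map j* from the continuous dual X' to the continuous dual Y', defined by j*(x') = x' ∘ j, has dense range in Y' (with respect to the dual/operator norm). Let 0 < T < ∞ and let f : [0,T] → Y be a function such that sup_{t ∈ [0,T]} ‖f(t)‖_Y < ∞ and such that j ∘ f : [0,T] → X is continuous. Then f is weakly continuous as a Y-valued function: for every continuous linear functional ℓ ∈ Y', the real-valued map t ↦ ℓ(f(t)) is continuous on [0,T]. -/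
/-- Lemma A.1: if `j : Y → X` is an injective continuous linear map between
real Banach spaces whose adjoint `j* : X' → Y'`, `j*(x') = x' ∘ j`, has dense range in `Y'`,
and `f : [0,T] → Y` is bounded with `j ∘ f` continuous, then `f` is weakly continuous
as a `Y`-valued function. -/
theorem bounded_strongX_continuous_implies_weaklyY_continuous
    (X Y : Type*) [NormedAddCommGroup X] [NormedSpace ℝ X] [CompleteSpace X]
    [NormedAddCommGroup Y] [NormedSpace ℝ Y] [CompleteSpace Y]
    (j : Y →L[ℝ] X) (hj : Function.Injective j)
    (hdense : DenseRange (fun x' : X →L[ℝ] ℝ => x'.comp j))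
    (T : ℝ) (hT : 0 < T) (f : ℝ → Y)
    (hbdd : ∃ M : ℝ, ∀ t ∈ Set.Icc (0 : ℝ) T, ‖f t‖ ≤ M)
    (hcont : ContinuousOn (fun t => j (f t)) (Set.Icc (0 : ℝ) T)) :
    ∀ ℓ : Y →L[ℝ] ℝ, ContinuousOn (fun t => ℓ (f t)) (Set.Icc (0 : ℝ) T) := by
  intro ℓ
  obtain ⟨M, hM⟩ := hbdd
  refine continuousOn_of_uniform_approx_of_continuousOn fun u hu => ?_
  obtain ⟨ε, hε, hεu⟩ := Metric.mem_uniformity_dist.1 hu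
  have hpos : 0 < |M| + 1 := by positivity
  obtain ⟨x', hx'⟩ := hdense.exists_dist_lt ℓ (div_pos hε hpos)
  refine ⟨fun t => x' (j (f t)), x'.continuous.comp_continuousOn hcont, fun t ht => hεu ?_⟩
  rw [dist_eq_norm] at hx' ⊢
  have hft : ‖f t‖ ≤ |M| + 1 := by linarith [hM t ht, le_abs_self M]
  calc ‖ℓ (f t) - x' (j (f t))‖ = ‖(ℓ - x'.comp j) (f t)‖ := rfl
    _ ≤ ‖ℓ - x'.comp j‖ * (|M| + 1) := (ℓ - x'.comp j).le_opNorm_of_le hft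
    _ < ε := (lt_div_iff₀ hpos).1 hx'
end
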